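/- Diagonal-to-off-diagonal relation within a block (lower diagonal entry): let λ be a Young diagram with at most d rows, let i, j ∈ [d], and let k ∈ [d−1] satisfy λ_k = λ_{k+1}. Then g(k+1, k+1) = (1 + 1/Δ) · g(k, k+1). -/

import Mathlib

open Finset

/-- The Weyl dimension polynomial `WD_p(mu) = prod_{1 <= a < b <= p} ((mu_a - mu_b) + (b - a))/(b - a)`
of the integer tuple `(mu 1, ..., mu p)`. -/
def weylDim (p : ℕ) (μ : ℕ → ℤ) : ℚ :=
  ∏ a ∈ Finset.Icc 1 p, ∏ b ∈ Finset.Icc (a + 1) p,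
    (((μ a : ℚ) - (μ b : ℚ)) + ((b : ℚ) - (a : ℚ))) / ((b : ℚ) - (a : ℚ))

/-- `addBox μ y = μ + e_y`: the tuple `μ` with `1` added in coordinate `y`. -/
def addBox (μ : ℕ → ℤ) (y : ℕ) : ℕ → ℤ := fun x => μ x + if x = y then 1 else 0

/-- The dimension ratio `D^μ_{k→y} = WD_k(μ + e_y)/WD_k(μ)` for `y ≤ k`, and `0` for `k < y`
(division by zero evaluates to `0`). -/
def dimRatio (μ : ℕ → ℤ) (k y : ℕ) : ℚ :=
  if y ≤ k then weylDim k (addBox μ y) / weylDim k μ else 0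

def intOf (lam : ℕ → ℕ) : ℕ → ℤ := fun x => (lam x : ℤ)

/-- `Δ = (λ_j − λ_i) + (i − j) + δ_{ij}`. -/
def Del (lam : ℕ → ℕ) (i j : ℕ) : ℚ :=
  (((lam j : ℚ) - (lam i : ℚ)) + ((i : ℚ) - (j : ℚ))) + (if i = j then 1 else 0)

/-- The partial-sum function `F(s, t)` of squared two-step Clebsch–Gordan coefficients. -/
def Fcoef (lam : ℕ → ℕ) (i j : ℕ) (s t : ℕ) : ℚ :=
  if s ≤ t then dimRatio (intOf lam) s i * dimRatio (addBox (intOf lam) i) t j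
  else
    dimRatio (intOf lam) t j * dimRatio (addBox (intOf lam) j) s i
      + 1 / Del lam i j ^ 2 *
          (dimRatio (intOf lam) t i * dimRatio (addBox (intOf lam) i) s j
            - dimRatio (intOf lam) t j * dimRatio (addBox (intOf lam) j) s i)

/-- The squared two-step Clebsch–Gordan coefficient `g(k, ℓ)`. -/
def gcoef (lam : ℕ → ℕ) (i j : ℕ) (k l : ℕ) : ℚ :=
  Fcoef lam i j k l - Fcoef lam i j (k - 1) l - Fcoef lam i j k (l - 1)
    + Fcoef lam i j (k - 1) (l - 1)

/-- `D_{s→ij}`. -/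
def dimR2 (lam : ℕ → ℕ) (i j s : ℕ) : ℚ :=
  if max i j ≤ s then weylDim s (addBox (addBox (intOf lam) i) j) / weylDim s (intOf lam)
  else 0

/-- `C^{λ+e_i}_j = λ_j + δ_{ij} − j`. -/
def rowContentAdd (lam : ℕ → ℕ) (i j : ℕ) : ℚ :=
  ((lam j : ℚ) + (if i = j then 1 else 0)) - (j : ℚ)

theorem weylDim_succ (p : ℕ) (μ : ℕ → ℤ) :
    weylDim (p + 1) μ = weylDim p μ * ∏ a ∈ Finset.Icc 1 p,
      (((μ a : ℚ) - (μ (p + 1) : ℚ)) + (((p + 1 : ℕ) : ℚ) - (a : ℚ))) /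
        (((p + 1 : ℕ) : ℚ) - (a : ℚ)) := by
  unfold weylDim
  rw [Finset.prod_Icc_succ_top (by omega), Finset.Icc_eq_empty_of_lt (by omega : p + 1 < p + 1 + 1),
    Finset.prod_empty, mul_one, ← Finset.prod_mul_distrib]
  refine Finset.prod_congr rfl fun a ha => ?_
  rw [Finset.mem_Icc] at ha
  rw [Finset.prod_Icc_succ_top (by omega)]

theorem addBox_comm (μ : ℕ → ℤ) (i j : ℕ) :
    addBox (addBox μ i) j = addBox (addBox μ j) i := by
  funext x
  simp only [addBox]
  ring

theorem addBox_self (μ : ℕ → ℤ) (y : ℕ) : addBox μ y y = μ y + 1 := by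
  simp [addBox]

theorem addBox_of_ne (μ : ℕ → ℤ) {x y : ℕ} (h : x ≠ y) : addBox μ y x = μ x := by
  simp [addBox, h]

theorem dimRatio_of_lt (μ : ℕ → ℤ) {k y : ℕ} (h : k < y) : dimRatio μ k y = 0 := by
  simp [dimRatio, h]

theorem dimRatio_of_le (μ : ℕ → ℤ) {k y : ℕ} (h : y ≤ k) :
    dimRatio μ k y = weylDim k (addBox μ y) / weylDim k μ := by
  simp [dimRatio, h]

/-- Passing from level `k` to `k + 1` multiplies the dimension ratio by one quotient of
hook-type factors. -/
theorem dimRatio_succ (μ : ℕ → ℤ) {k y : ℕ} (hy : 1 ≤ y) (hyk : y ≤ k)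
    (h : ∀ a, 1 ≤ a → a ≤ k → (μ a : ℚ) - a ≠ μ (k + 1) - (k + 1)) :
    dimRatio μ (k + 1) y * ((μ y - y) - (μ (k + 1) - (k + 1))) =
      dimRatio μ k y * ((μ y - y) + 1 - (μ (k + 1) - (k + 1))) := by
  have hmem : y ∈ Finset.Icc 1 k := Finset.mem_Icc.2 ⟨hy, hyk⟩
  rw [dimRatio_of_le μ hyk, dimRatio_of_le μ (by omega), weylDim_succ, weylDim_succ,
    ← Finset.mul_prod_erase _ _ hmem, ← Finset.mul_prod_erase _ _ hmem,
    addBox_self, addBox_of_ne μ (by omega : k + 1 ≠ y)]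
  have hcongr : ∀ a ∈ (Finset.Icc 1 k).erase y,
      (((addBox μ y a : ℚ) - (μ (k + 1) : ℚ)) + (((k + 1 : ℕ) : ℚ) - (a : ℚ))) /
        (((k + 1 : ℕ) : ℚ) - (a : ℚ)) =
      (((μ a : ℚ) - (μ (k + 1) : ℚ)) + (((k + 1 : ℕ) : ℚ) - (a : ℚ))) /
        (((k + 1 : ℕ) : ℚ) - (a : ℚ)) := fun a ha => by
    rw [addBox_of_ne μ (Finset.ne_of_mem_erase ha)]
  rw [Finset.prod_congr rfl hcongr]
  have hden : ∀ a ≤ k, ((k + 1 : ℕ) : ℚ) - (a : ℚ) ≠ 0 := fun a ha => by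
    rw [sub_ne_zero]
    exact_mod_cast (by omega : k + 1 ≠ a)
  have hP : ∏ a ∈ (Finset.Icc 1 k).erase y,
      (((μ a : ℚ) - (μ (k + 1) : ℚ)) + (((k + 1 : ℕ) : ℚ) - (a : ℚ))) /
        (((k + 1 : ℕ) : ℚ) - (a : ℚ)) ≠ 0 := by
    refine Finset.prod_ne_zero_iff.2 fun a ha => ?_
    have ha' := Finset.mem_Icc.1 (Finset.mem_of_mem_erase ha)
    refine div_ne_zero (fun h0 => h a ha'.1 ha'.2 ?_) (hden a ha'.2)
    push_cast at h0
    linarith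
  have hQ : (((μ y : ℚ) - (μ (k + 1) : ℚ)) + (((k + 1 : ℕ) : ℚ) - (y : ℚ))) ≠ 0 := fun h0 => by
    refine h y hy hyk ?_
    push_cast at h0
    linarith
  have hR := hden y hyk
  generalize ∏ a ∈ (Finset.Icc 1 k).erase y,
      (((μ a : ℚ) - (μ (k + 1) : ℚ)) + (((k + 1 : ℕ) : ℚ) - (a : ℚ))) /
        (((k + 1 : ℕ) : ℚ) - (a : ℚ)) = P at hP ⊢
  by_cases hW : weylDim k μ = 0
  · simp [hW]
  · field_simp
    push_cast
    ring

/-- No box can be added at the bottom of two adjacent equal rows. -/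
theorem dimRatio_eq_zero_of_eq (μ : ℕ → ℤ) {k : ℕ} (hk : 1 ≤ k) (h : μ k = μ (k + 1)) :
    dimRatio μ (k + 1) (k + 1) = 0 := by
  rw [dimRatio_of_le μ le_rfl, weylDim_succ,
    Finset.prod_eq_zero (Finset.mem_Icc.2 ⟨hk, le_rfl⟩), mul_zero, zero_div]
  rw [addBox_self, addBox_of_ne μ (by omega : k ≠ k + 1), h]
  push_cast
  ring

theorem weylDim_addBox_addBox_of_lt (μ : ℕ → ℤ) {p i j : ℕ} (hi : 1 ≤ i) (hij : i < j)
    (hj : j ≤ p) :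
    weylDim p (addBox (addBox μ i) j) * weylDim p μ *
        (((μ j - j : ℚ) - (μ i - i)) ^ 2 - 1) =
      weylDim p (addBox μ i) * weylDim p (addBox μ j) * ((μ j - j : ℚ) - (μ i - i)) ^ 2 := by
  have hmem : (⟨i, j⟩ : (_ : ℕ) × ℕ) ∈ (Finset.Icc 1 p).sigma fun a => Finset.Icc (a + 1) p := by
    simp only [Finset.mem_sigma, Finset.mem_Icc]
    omega
  have hne : (j : ℚ) - i ≠ 0 := by
    rw [sub_ne_zero]
    exact_mod_cast hij.ne'
  unfold weylDim
  simp only [Finset.prod_sigma']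
  rw [← Finset.prod_mul_distrib, ← Finset.prod_mul_distrib, ← Finset.mul_prod_erase _ _ hmem,
    ← Finset.mul_prod_erase _ _ hmem]
  have hcongr : ∀ x ∈ ((Finset.Icc 1 p).sigma fun a => Finset.Icc (a + 1) p).erase ⟨i, j⟩,
      (((addBox (addBox μ i) j x.1 : ℚ) - (addBox (addBox μ i) j x.2 : ℚ)) +
            ((x.2 : ℚ) - (x.1 : ℚ))) / ((x.2 : ℚ) - (x.1 : ℚ)) *
          ((((μ x.1 : ℚ) - (μ x.2 : ℚ)) + ((x.2 : ℚ) - (x.1 : ℚ))) / ((x.2 : ℚ) - (x.1 : ℚ))) =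
        (((addBox μ i x.1 : ℚ) - (addBox μ i x.2 : ℚ)) +
            ((x.2 : ℚ) - (x.1 : ℚ))) / ((x.2 : ℚ) - (x.1 : ℚ)) *
          ((((addBox μ j x.1 : ℚ) - (addBox μ j x.2 : ℚ)) + ((x.2 : ℚ) - (x.1 : ℚ))) /
            ((x.2 : ℚ) - (x.1 : ℚ))) := by
    rintro ⟨a, b⟩ hx
    simp only [Finset.mem_erase, Finset.mem_sigma, Finset.mem_Icc, ne_eq, Sigma.mk.injEq,
      heq_eq_eq] at hx
    simp only [addBox]
    by_cases h1 : a = i <;> by_cases h2 : b = j <;> by_cases h3 : a = j <;> by_cases h4 : b = i <;>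
      first
      | omega
      | (simp only [h1, h2, h3, h4, hij.ne, hij.ne', if_true, if_false]; push_cast; ring)
  rw [Finset.prod_congr rfl hcongr]
  simp only [addBox_self, addBox_of_ne _ hij.ne, addBox_of_ne _ hij.ne']
  field_simp
  push_cast
  ring

theorem weylDim_addBox_addBox (μ : ℕ → ℤ) {p i j : ℕ} (hi : 1 ≤ i) (hj : 1 ≤ j) (hij : i ≠ j)
    (hip : i ≤ p) (hjp : j ≤ p) :
    weylDim p (addBox (addBox μ i) j) * weylDim p μ *
        (((μ j - j : ℚ) - (μ i - i)) ^ 2 - 1) =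
      weylDim p (addBox μ i) * weylDim p (addBox μ j) * ((μ j - j : ℚ) - (μ i - i)) ^ 2 := by
  rcases lt_or_gt_of_ne hij with h | h
  · exact weylDim_addBox_addBox_of_lt μ hi h hjp
  · have := weylDim_addBox_addBox_of_lt μ hj h hip
    rw [addBox_comm]
    linear_combination this

theorem dimRatio_mul_dimRatio_addBox (μ : ℕ → ℤ) {p i j : ℕ} (hi : 1 ≤ i) (hj : 1 ≤ j)
    (hij : i ≠ j) (hip : i ≤ p) (hjp : j ≤ p) :
    dimRatio μ p i * dimRatio (addBox μ i) p j * (((μ j - j : ℚ) - (μ i - i)) ^ 2 - 1) =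
      dimRatio μ p i * dimRatio μ p j * ((μ j - j : ℚ) - (μ i - i)) ^ 2 := by
  have h := weylDim_addBox_addBox μ hi hj hij hip hjp
  simp only [dimRatio_of_le _ hip, dimRatio_of_le _ hjp]
  by_cases h0 : weylDim p μ = 0
  · simp [h0]
  by_cases h1 : weylDim p (addBox μ i) = 0
  · simp [h1]
  field_simp
  linear_combination h

theorem rows_antitone {d : ℕ} {lam : ℕ → ℕ}
    (hlam : ∀ k, 1 ≤ k → k + 1 ≤ d → lam (k + 1) ≤ lam k) {a b : ℕ} (ha : 1 ≤ a) (hab : a ≤ b)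
    (hb : b ≤ d) : lam b ≤ lam a := by
  induction b, hab using Nat.le_induction with
  | base => exact le_rfl
  | succ n hn ih => exact (hlam n (by omega) hb).trans (ih (by omega))

theorem two_step_lower_diagonal_relation
    (d : ℕ) (hd : 1 ≤ d) (lam : ℕ → ℕ)
    (hlam : ∀ k, 1 ≤ k → k + 1 ≤ d → lam (k + 1) ≤ lam k)
    (i j : ℕ) (hi : i ∈ Finset.Icc 1 d) (hj : j ∈ Finset.Icc 1 d)
    (k : ℕ) (hk1 : 1 ≤ k) (hk2 : k + 1 ≤ d) (hblock : lam k = lam (k + 1)) :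
    gcoef lam i j (k + 1) (k + 1) = (1 + 1 / Del lam i j) * gcoef lam i j k (k + 1) := by
  obtain ⟨hi1, hid⟩ := Finset.mem_Icc.1 hi
  obtain ⟨hj1, hjd⟩ := Finset.mem_Icc.1 hj
  obtain ⟨m, rfl⟩ : ∃ m, k = m + 1 := ⟨k - 1, by omega⟩
  have hcont : ∀ a b, 1 ≤ a → a < b → b ≤ d → (lam b : ℚ) - b < lam a - a := fun a b ha hab hb => by
    have h1 : (lam b : ℚ) ≤ lam a := by exact_mod_cast rows_antitone hlam ha hab.le hb
    have h2 : (a : ℚ) < b := by exact_mod_cast hab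
    linarith
  have hblockQ : (lam (m + 1) : ℚ) = lam (m + 1 + 1) := by exact_mod_cast hblock
  have hblockZ : intOf lam (m + 1) = intOf lam (m + 1 + 1) := by simp [intOf, hblock]
  have hstep : ∀ y n, 1 ≤ y → y ≤ n → n + 1 ≤ d →
      dimRatio (intOf lam) (n + 1) y * ((lam y - y : ℚ) - (lam (n + 1) - (n + 1))) =
        dimRatio (intOf lam) n y * ((lam y - y : ℚ) + 1 - (lam (n + 1) - (n + 1))) := by
    intro y n hy hyn hn
    have h := dimRatio_succ (intOf lam) hy hyn fun a ha han => by
      have := hcont a (n + 1) ha (by omega) hn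
      push_cast at this
      simpa [intOf] using this.ne'
    simpa [intOf] using h
  have hstepAdd : ∀ x y, x ≤ m + 1 → 1 ≤ y → y ≤ m + 1 →
      dimRatio (addBox (intOf lam) x) (m + 2) y *
          ((lam y - y : ℚ) + (if x = y then 1 else 0) - (lam (m + 1) - (m + 2))) =
        dimRatio (addBox (intOf lam) x) (m + 1) y *
          ((lam y - y : ℚ) + (if x = y then 1 else 0) + 1 - (lam (m + 1) - (m + 2))) := by
    intro x y hx hy hym
    have h := dimRatio_succ (addBox (intOf lam) x) hy hym fun a ha ham => by
      have h1 := hcont a (m + 1 + 1) ha (by omega) hk2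
      have h2 : (intOf lam a : ℚ) ≤ addBox (intOf lam) x a := by
        simp only [addBox]
        split_ifs <;> simp
      rw [addBox_of_ne _ (by omega : m + 1 + 1 ≠ x)]
      simp only [intOf] at h2 ⊢
      push_cast at h1 h2 ⊢
      exact (h1.trans_le (by linarith)).ne'
    rw [addBox_of_ne _ (by omega : m + 1 + 1 ≠ x)] at h
    simp only [addBox, intOf, eq_comm (a := y)] at h
    push_cast at h
    rw [hblockQ]
    linear_combination h
  have hDel : i ≠ j → Del lam i j = (lam j - j : ℚ) - (lam i - i) := fun h => by
    simp only [Del, if_neg h]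
    ring
  simp only [gcoef, Fcoef, Nat.add_sub_cancel, le_refl, if_true, Nat.le_succ,
    show ¬ m + 1 + 1 ≤ m + 1 by omega, show m ≤ m + 1 + 1 by omega, if_false]
  rcases Nat.lt_or_ge (m + 1) i with him | him
  · have hA2 : dimRatio (intOf lam) (m + 1 + 1) i = 0 := by
      rcases Nat.lt_or_ge (m + 1 + 1) i with h | h
      · exact dimRatio_of_lt _ h
      · obtain rfl : i = m + 1 + 1 := by omega
        exact dimRatio_eq_zero_of_eq _ hk1 hblockZ
    have hzero : (1 - 1 / Del lam i j ^ 2) * (dimRatio (intOf lam) (m + 1) j *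
        dimRatio (addBox (intOf lam) j) (m + 1 + 1) i) = 0 := by
      rcases Nat.lt_or_ge (m + 1 + 1) i with h | h
      · rw [dimRatio_of_lt (addBox (intOf lam) j) h]
        ring
      obtain rfl : i = m + 1 + 1 := by omega
      rcases Nat.lt_trichotomy j (m + 1) with h | rfl | h
      · rw [dimRatio_eq_zero_of_eq (addBox (intOf lam) j) hk1]
        · ring
        · rw [addBox_of_ne _ (by omega), addBox_of_ne _ (by omega), hblockZ]
      · rw [hDel (by omega), hblockQ]
        push_cast
        ring
      · rw [dimRatio_of_lt (intOf lam) h]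
        ring
    rw [hA2, dimRatio_of_lt (intOf lam) him, dimRatio_of_lt (intOf lam) (by omega : m < i)]
    linear_combination -hzero
  have hp : (lam i - i : ℚ) - (lam (m + 1) - (m + 2)) ≠ 0 := by
    have h := hcont i (m + 1 + 1) hi1 (by omega) hk2
    rw [hblockQ]
    push_cast at h
    linarith
  have hA0 : dimRatio (intOf lam) (m + 1) i * ((lam i - i : ℚ) - (lam (m + 1) - (m + 1))) =
      dimRatio (intOf lam) m i * ((lam i - i : ℚ) - (lam (m + 1) - (m + 2))) := by
    rcases Nat.lt_or_ge m i with h | h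
    · obtain rfl : i = m + 1 := by omega
      rw [dimRatio_of_lt (intOf lam) h]
      push_cast
      ring
    · have := hstep i m hi1 h (by omega)
      linear_combination this
  have hA2 := hstep i (m + 1) hi1 him hk2
  rw [← hblockQ] at hA2
  push_cast at hA2
  rcases Nat.lt_or_ge (m + 1) j with hjm | hjm
  · rw [dimRatio_of_lt (addBox (intOf lam) i) hjm, dimRatio_of_lt (intOf lam) hjm]
    rcases Nat.lt_or_ge (m + 1 + 1) j with h | h
    · rw [dimRatio_of_lt (addBox (intOf lam) i) h]
      ring
    obtain rfl : j = m + 1 + 1 := by omega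
    rcases Nat.lt_or_ge i (m + 1) with h | h
    · rw [dimRatio_eq_zero_of_eq (addBox (intOf lam) i) hk1]
      · ring
      · rw [addBox_of_ne _ (by omega), addBox_of_ne _ (by omega), hblockZ]
    · obtain rfl : i = m + 1 := by omega
      have hD : Del lam (m + 1) (m + 1 + 1) = -1 := by
        rw [hDel (by omega), hblockQ]
        push_cast
        ring
      rw [hD]
      push_cast at hA2
      linear_combination dimRatio (addBox (intOf lam) (m + 1)) (m + 1 + 1) (m + 1 + 1) * hA2
  have hq : (lam j - j : ℚ) - (lam (m + 1) - (m + 2)) ≠ 0 := by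
    have h := hcont j (m + 1 + 1) hj1 (by omega) hk2
    rw [hblockQ]
    push_cast at h
    linarith
  have hB := hstepAdd i j him hj1 hjm
  have hB' := hstepAdd j i hjm hi1 him
  rcases eq_or_ne i j with rfl | hij
  · have hq' : (lam i - i : ℚ) - (lam (m + 1) - (m + 2)) + 1 ≠ 0 := by
      have h := hcont i (m + 1 + 1) hi1 (by omega) hk2
      rw [hblockQ]
      push_cast at h
      linarith
    have hD : Del lam i i = 1 := by simp [Del]
    rw [hD]
    simp only [if_true] at hB
    generalize hP : (lam i - i : ℚ) - (lam (m + 1) - (m + 2)) = P at hp hq'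
    obtain hx : (lam i - i : ℚ) = P + (lam (m + 1) - (m + 2)) := by linarith
    rw [hx] at hA0 hA2 hB
    have hA0' := eq_div_of_mul_eq hp (by linear_combination -hA0 :
      dimRatio (intOf lam) m i * P = dimRatio (intOf lam) (m + 1) i * (P - 1))
    have hA2' := eq_div_of_mul_eq hp (by linear_combination hA2 :
      dimRatio (intOf lam) (m + 1 + 1) i * P = dimRatio (intOf lam) (m + 1) i * (P + 1))
    have hB2' := eq_div_of_mul_eq hq' (by linear_combination hB :
      dimRatio (addBox (intOf lam) i) (m + 1 + 1) i * (P + 1) =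
        dimRatio (addBox (intOf lam) i) (m + 1) i * (P + 2))
    rw [hA0', hA2', hB2']
    field_simp
    ring
  · have hdiamond := dimRatio_mul_dimRatio_addBox (intOf lam) hi1 hj1 hij him hjm
    have hdiamond' := dimRatio_mul_dimRatio_addBox (intOf lam) hj1 hi1 hij.symm hjm him
    have hD0 : (lam j - j : ℚ) - (lam i - i) ≠ 0 := by
      rcases lt_or_gt_of_ne hij with h | h
      · have := hcont i j hi1 h hjd
        linarith
      · have := hcont j i hj1 h hid
        linarith
    rw [hDel hij]
    have hcast : ∀ x, (intOf lam x : ℚ) = lam x := fun x => by simp [intOf]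
    simp only [hcast] at hdiamond hdiamond'
    simp only [if_neg hij] at hB
    simp only [if_neg hij.symm] at hB'
    generalize hP : (lam i - i : ℚ) - (lam (m + 1) - (m + 2)) = P at hp
    generalize hQ : (lam j - j : ℚ) - (lam (m + 1) - (m + 2)) = Q at hq
    have hx : (lam i - i : ℚ) = P + (lam (m + 1) - (m + 2)) := by linarith
    have hy : (lam j - j : ℚ) = Q + (lam (m + 1) - (m + 2)) := by linarith
    rw [hx] at hA0 hA2 hB'
    rw [hy] at hB
    have hxy : (lam j - j : ℚ) - (lam i - i) = Q - P := by linarith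
    have hyx : (lam i - i : ℚ) - (lam j - j) = P - Q := by linarith
    rw [hxy] at hdiamond hD0 ⊢
    rw [hyx] at hdiamond'
    have hA0' := eq_div_of_mul_eq hp (by linear_combination -hA0 :
      dimRatio (intOf lam) m i * P = dimRatio (intOf lam) (m + 1) i * (P - 1))
    have hA2' := eq_div_of_mul_eq hp (by linear_combination hA2 :
      dimRatio (intOf lam) (m + 1 + 1) i * P = dimRatio (intOf lam) (m + 1) i * (P + 1))
    have hB2 := eq_div_of_mul_eq hq (by linear_combination hB :
      dimRatio (addBox (intOf lam) i) (m + 1 + 1) j * Q =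
        dimRatio (addBox (intOf lam) i) (m + 1) j * (Q + 1))
    have hB2' := eq_div_of_mul_eq hp (by linear_combination hB' :
      dimRatio (addBox (intOf lam) j) (m + 1 + 1) i * P =
        dimRatio (addBox (intOf lam) j) (m + 1) i * (P + 1))
    rw [hA0', hA2', hB2, hB2']
    generalize dimRatio (intOf lam) (m + 1) i = A at *
    generalize dimRatio (intOf lam) (m + 1) j = A' at *
    generalize dimRatio (addBox (intOf lam) i) (m + 1) j = B at *
    generalize dimRatio (addBox (intOf lam) j) (m + 1) i = B' at *
    field_simp
    linear_combination (P + 1) * Q * (hdiamond - hdiamond')
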